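/- There exist C₁ > 0, a finite set A ⊂ ℤ[√2]² and s₀ > 0 with the following properties: every (α₃,α₄) ∈ A satisfies α₃ > 0 and α₃, α₄ coprime in ℤ[√2], the quotients α₄/α₃ for (α₃,α₄) ∈ A are pairwise distinct, and for every s ≥ s₀: (i) the boxes B(α₃,α₄) = {(x₁,x₂) ∈ ℝ² : |x₁ + α₄/α₃| ≤ C₁ s^{−1/2} and |x₂ + σ(α₄)/σ(α₃)| ≤ C₁ s^{−1/2}}, (α₃,α₄) ∈ A, are pairwise disjoint; (ii) for every z₂ with |z₂| < θ̂^{−1/2}s^{1/2}, every w ∈ 𝒲' and every (x₁,x₂) ∈ 𝔉 for which 𝓛h ∩ 𝒯(s) = ∅, one has (x₁,x₂) ∈ B(α₃,α₄) for some (α₃,α₄) ∈ A. -/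

import Mathlib

open MeasureTheory Matrix Set Pointwise

noncomputable section

/-- The real embedding of `ℤ[√2]`, `a + b√2 ↦ a + b√2`. -/
def emb (α : Zsqrtd 2) : ℝ := (α.re : ℝ) + (α.im : ℝ) * Real.sqrt 2

/-- The Galois-conjugate embedding `σ`, `a + b√2 ↦ a − b√2`. -/
def embc (α : Zsqrtd 2) : ℝ := (α.re : ℝ) - (α.im : ℝ) * Real.sqrt 2

/-- The fundamental unit `λ = 1 + √2`. -/
def lam : ℝ := 1 + Real.sqrt 2

/-- `𝓛'`: the Minkowski embedding of `ℤ[√2]` in `ℝ²`. -/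
def Lp : Set (ℝ × ℝ) := {p | ∃ α : Zsqrtd 2, p = (emb α, embc α)}

/-- `v(β₁,β₂) = (β₁, β₂, σ(β₁), σ(β₂))`. -/
def latvec (β₁ β₂ : Zsqrtd 2) : Fin 4 → ℝ := ![emb β₁, emb β₂, embc β₁, embc β₂]

/-- `𝓛`: the Minkowski embedding of `ℤ[√2]²` in `ℝ⁴`. -/
def Lquad : Set (Fin 4 → ℝ) := {v | ∃ β₁ β₂ : Zsqrtd 2, v = latvec β₁ β₂}

/-- `𝓛h`, for a 4×4 real matrix `h` (row vectors, right multiplication). -/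
def latimage (h : Matrix (Fin 4) (Fin 4) ℝ) : Set (Fin 4 → ℝ) :=
  (fun v => Matrix.vecMul v h) '' Lquad

def nmat (x : ℝ) : Matrix (Fin 2) (Fin 2) ℝ := !![1, x; 0, 1]
def amat (y : ℝ) : Matrix (Fin 2) (Fin 2) ℝ := !![y, 0; 0, y⁻¹]
def kmat (θ : ℝ) : Matrix (Fin 2) (Fin 2) ℝ :=
  !![Real.cos θ, -Real.sin θ; Real.sin θ, Real.cos θ]

/-- Block diagonal 4×4 matrix from two 2×2 blocks. -/
def bd (A B : Matrix (Fin 2) (Fin 2) ℝ) : Matrix (Fin 4) (Fin 4) ℝ :=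
  !![A 0 0, A 0 1, 0, 0;
     A 1 0, A 1 1, 0, 0;
     0, 0, B 0 0, B 0 1;
     0, 0, B 1 0, B 1 1]

/-- `h(x₁,x₂,y₁,y₂,θ₁,θ₂) = diag(n(x₁)a(y₁)k(θ₁), n(x₂)a(y₂)k(θ₂))`. -/
def hmat (x₁ x₂ y₁ y₂ θ₁ θ₂ : ℝ) : Matrix (Fin 4) (Fin 4) ℝ :=
  bd (nmat x₁ * amat y₁ * kmat θ₁) (nmat x₂ * amat y₂ * kmat θ₂)

/-- `H = SL₂(ℝ)² ⊂ SL₄(ℝ)` (block diagonal). -/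
def Hset : Set (Matrix (Fin 4) (Fin 4) ℝ) :=
  {h | ∃ A B : Matrix (Fin 2) (Fin 2) ℝ, A.det = 1 ∧ B.det = 1 ∧ h = bd A B}

/-- `Γ_K = {diag(A, σ(A)) : A ∈ SL₂(ℤ[√2])}`. -/
def GammaK : Set (Matrix (Fin 4) (Fin 4) ℝ) :=
  {g | ∃ A : Matrix (Fin 2) (Fin 2) (Zsqrtd 2), A.det = 1 ∧ g = bd (A.map emb) (A.map embc)}

/-- `𝒲`: the open regular octagon of side length √2. -/
def Woct : Set (ℝ × ℝ) :=
  {p | |p.1| < lam / Real.sqrt 2 ∧ |p.2| < lam / Real.sqrt 2 ∧ |p.1| + |p.2| < lam}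

/-- `𝒲' = 𝒲 ∖ (√2−1)𝒲`. -/
def Wp : Set (ℝ × ℝ) := Woct \ ((Real.sqrt 2 - 1) • Woct)

/-- `θ̂ = 48√2/π⁴`, the density of visible points. -/
def thetaHat : ℝ := 48 * Real.sqrt 2 / Real.pi ^ 4

/-- `T(s)`: open triangle with vertices `(0,0)`, `(s/θ̂)^{1/2}(1,±1)`. -/
def Tset (s : ℝ) : Set (ℝ × ℝ) :=
  {p | 0 < p.1 ∧ p.1 < Real.sqrt (s / thetaHat) ∧ |p.2| < p.1}

/-- `𝔉`: a fundamental domain of `𝓛'`. -/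
def Fdom : Set (ℝ × ℝ) :=
  {p | ∃ r₁ ∈ Set.Ico (0:ℝ) 1, ∃ r₂ ∈ Set.Ico (0:ℝ) 1,
    p = (1 + r₁ + r₂ * Real.sqrt 2, 2 + r₁ - r₂ * Real.sqrt 2)}

/-- The Siegel domain `𝔇_t`. -/
def Dset (t : ℝ) : Set (Matrix (Fin 4) (Fin 4) ℝ) :=
  {h | ∃ x₁ x₂ y₁ y₂ θ₁ θ₂ : ℝ, (x₁, x₂) ∈ Fdom ∧ 0 < y₁ ∧ 0 < y₂ ∧ t ≤ y₁ * y₂ ∧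
    lam ^ (-2 : ℤ) ≤ y₁ / y₂ ∧ y₁ / y₂ ≤ lam ^ 2 ∧
    θ₁ ∈ Set.Ico 0 Real.pi ∧ θ₂ ∈ Set.Ico 0 Real.pi ∧ h = hmat x₁ x₂ y₁ y₂ θ₁ θ₂}

/-- Row vector times 2×2 matrix, on `ℝ × ℝ`. -/
def mul2 (p : ℝ × ℝ) (M : Matrix (Fin 2) (Fin 2) ℝ) : ℝ × ℝ :=
  (p.1 * M 0 0 + p.2 * M 1 0, p.1 * M 0 1 + p.2 * M 1 1)

/-- `r(s)`: the unique integer with `λ^{2r} ≤ s^{1/4} < λ^{2(r+1)}`. -/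
def rr (s : ℝ) : ℤ := ⌊Real.logb (lam ^ 2) (s ^ ((1:ℝ)/4))⌋

/-- `𝒯(s)` with explicit integer `r`: `λ^{−2r}T(s) × λ^{2r}𝒲`. -/
def calT (s : ℝ) (r : ℤ) : Set (Fin 4 → ℝ) :=
  {v | (lam ^ (2*r) * v 0, lam ^ (2*r) * v 1) ∈ Tset s ∧
       (lam ^ (-(2*r)) * v 2, lam ^ (-(2*r)) * v 3) ∈ Woct}

/-- `𝒯(s) = λ^{−2r(s)}T(s) × λ^{2r(s)}𝒲`. -/
def calTs (s : ℝ) : Set (Fin 4 → ℝ) := calT s (rr s)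

/-- Euclidean norm on `ℝ⁴`. -/
def enorm4 (v : Fin 4 → ℝ) : ℝ := Real.sqrt (∑ i, (v i) ^ 2)

/-- `𝓛h̃ = (ℤ(y₁,0,y₂,0) + ℤ√2(y₁,0,−y₂,0) + ℝ(0,1,0,0) + ℝ(0,0,0,1))·diag(k(θ₁),k(θ₂))`. -/
def Ltilde (y₁ y₂ θ₁ θ₂ : ℝ) : Set (Fin 4 → ℝ) :=
  {v | ∃ (m n : ℤ) (c₁ c₂ : ℝ),
    v = Matrix.vecMul ![((m:ℝ) + (n:ℝ) * Real.sqrt 2) * y₁, c₁,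
          ((m:ℝ) - (n:ℝ) * Real.sqrt 2) * y₂, c₂] (bd (kmat θ₁) (kmat θ₂))}

open Classical in
/-- Real-valued indicator of a proposition. -/
def ind (P : Prop) : ℝ := if P then 1 else 0

/-- `c_H = 3/π⁴`. -/
def cH : ℝ := 3 / Real.pi ^ 4

/-- `Y_t = {(y₁,y₂) : y₁,y₂ > 0, y₁y₂ ≥ t, y₁/y₂ ∈ (λ⁻²,λ²)}`. -/
def Yt (t : ℝ) : Set (ℝ × ℝ) :=
  {y | 0 < y.1 ∧ 0 < y.2 ∧ t ≤ y.1 * y.2 ∧ lam ^ (-2:ℤ) < y.1 / y.2 ∧ y.1 / y.2 < lam ^ 2}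

/-- The main term `G_M(s)` (depending on the Siegel-domain parameter `t`). -/
def GM (t s : ℝ) : ℝ :=
  cH * ∫ θ₂ in Set.Ico (0:ℝ) Real.pi, ∫ θ₁ in Set.Ico (0:ℝ) Real.pi, ∫ y in Yt t, ∫ x in Fdom,
    (y.1 ^ 3 * y.2 ^ 3)⁻¹ * ind (Ltilde y.1 y.2 θ₁ θ₂ ∩ calTs s = ∅)

/-- The error term `G_E(s)`. -/
def GE (t s : ℝ) : ℝ :=
  cH * ∫ θ₂ in Set.Ico (0:ℝ) Real.pi, ∫ θ₁ in Set.Ico (0:ℝ) Real.pi, ∫ y in Yt t, ∫ x in Fdom,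
    (y.1 ^ 3 * y.2 ^ 3)⁻¹ *
      ind (latimage (hmat x.1 x.2 y.1 y.2 θ₁ θ₂) ∩ calTs s = ∅ ∧
           (Ltilde y.1 y.2 θ₁ θ₂ ∩ calTs s).Nonempty)

/-- `J = [0,π/4] ∪ [3π/4,π)`. -/
def Jset : Set ℝ := Set.Icc 0 (Real.pi/4) ∪ Set.Ico (3*Real.pi/4) Real.pi

/-- `Y = {(y₁,y₂) : y₁ > 0, 1 < y₂ < λ²}`. -/
def Yset : Set (ℝ × ℝ) := {y | 0 < y.1 ∧ 1 < y.2 ∧ y.2 < lam ^ 2}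

/-- `T₁`: open triangle with vertices `(0,0)`, `(1,±1)`. -/
def T1 : Set (ℝ × ℝ) := {p | 0 < p.1 ∧ p.1 < 1 ∧ |p.2| < p.1}

/-- `ℓ₁(θ₁)`: first-coordinate projection of `θ̂^{−1/2}T₁k(−θ₁)`. -/
def ell1 (θ₁ : ℝ) : Set ℝ :=
  {x | ∃ p ∈ T1, x = (mul2 ((Real.sqrt thetaHat)⁻¹ • p) (kmat (-θ₁))).1}

/-- `ℓ₂(θ₂)`: first-coordinate projection of `𝒲k(−θ₂)`. -/
def ell2 (θ₂ : ℝ) : Set ℝ := {x | ∃ p ∈ Woct, x = (mul2 p (kmat (-θ₂))).1}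

/-- `C_𝒫 = 2304(2−√2)/π⁸`. -/
def CP : ℝ := 2304 * (2 - Real.sqrt 2) / Real.pi ^ 8

/-- `ζ_K(2) = π⁴/(48√2)`. -/
def zetaK2 : ℝ := Real.pi ^ 4 / (48 * Real.sqrt 2)

/-- `𝒯'(s) = T(s) × 𝒲`. -/
def Tprime (s : ℝ) : Set (Fin 4 → ℝ) :=
  {v | (v 0, v 1) ∈ Tset s ∧ (v 2, v 3) ∈ Woct}

/-- `L₁(θ₁)` from Lemma 3.4: projection of `λ^{−2r}T(s)k(−θ₁)` onto the x-axis. -/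
def L1set (s : ℝ) (r : ℤ) (θ₁ : ℝ) : Set ℝ :=
  {x | ∃ p ∈ Tset s, x = (mul2 ((lam ^ (-(2*r)) : ℝ) • p) (kmat (-θ₁))).1}

/-- `L₂(θ₂)`: projection of `λ^{2r}𝒲k(−θ₂)` onto the x-axis. -/
def L2set (r : ℤ) (θ₂ : ℝ) : Set ℝ :=
  {x | ∃ p ∈ Woct, x = (mul2 ((lam ^ (2*r) : ℝ) • p) (kmat (-θ₂))).1}

/-- `n(x)a(y)k(θ)` where `y,θ` are determined by `y⁻¹(sin θ, cos θ) = z`. -/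
def hz (z : ℝ × ℝ) (x : ℝ) : Matrix (Fin 2) (Fin 2) ℝ :=
  nmat x * amat (Real.sqrt (z.1 ^ 2 + z.2 ^ 2))⁻¹ *
    !![(Real.sqrt (z.1 ^ 2 + z.2 ^ 2))⁻¹ * z.2, -((Real.sqrt (z.1 ^ 2 + z.2 ^ 2))⁻¹ * z.1);
       (Real.sqrt (z.1 ^ 2 + z.2 ^ 2))⁻¹ * z.1, (Real.sqrt (z.1 ^ 2 + z.2 ^ 2))⁻¹ * z.2]

/-- The function `F₂` of Lemma 4.7. -/
def F2 (z₁ : ℝ) : ℝ :=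
  (24 / Real.pi ^ 4) * ∫ z₂ in Set.Ioo (-z₁) z₁, ∫ w in Wp, ∫ x in Fdom,
    ind (latimage (bd (hz (z₁, z₂) x.1) (hz w x.2)) ∩ Tprime (z₁ ^ 2 * thetaHat) = ∅)

/-- The box `B(α₃,α₄)`. -/
def Bbox (α₃ α₄ : Zsqrtd 2) (C₁ s : ℝ) : Set (ℝ × ℝ) :=
  {x | |x.1 + emb α₄ / emb α₃| ≤ C₁ / Real.sqrt s ∧
       |x.2 + embc α₄ / embc α₃| ≤ C₁ / Real.sqrt s}

/-- The matrix `h` determined by `s, z₂, w, x₁, x₂` via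
`y₁⁻¹(sin θ₁, cos θ₁) = λ^{−2r}(θ̂^{−1/2}s^{1/2}, z₂)`, `y₂⁻¹(sin θ₂, cos θ₂) = λ^{2r}w`. -/
def hfull (s z₂ : ℝ) (w : ℝ × ℝ) (x₁ x₂ : ℝ) : Matrix (Fin 4) (Fin 4) ℝ :=
  bd (hz ((lam ^ (-(2 * rr s)) : ℝ) • (Real.sqrt (s / thetaHat), z₂)) x₁)
     (hz ((lam ^ (2 * rr s) : ℝ) • w) x₂)

/-- `F⁺_{(α₃,α₄)}(s)`. -/
def Fplus (α₃ α₄ : Zsqrtd 2) (C₁ s : ℝ) : ℝ :=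
  (Real.sqrt s)⁻¹ * ∫ z₂ in Set.Ioo (0:ℝ) (Real.sqrt (s / thetaHat)), ∫ w in Wp,
    ∫ x in Bbox α₃ α₄ C₁ s, ind (latimage (hfull s z₂ w x.1 x.2) ∩ calTs s = ∅)

/-- `F⁻_{(α₃,α₄)}(s)`. -/
def Fminus (α₃ α₄ : Zsqrtd 2) (C₁ s : ℝ) : ℝ :=
  (Real.sqrt s)⁻¹ * ∫ z₂ in Set.Ioo (-Real.sqrt (s / thetaHat)) (0:ℝ), ∫ w in Wp,
    ∫ x in Bbox α₃ α₄ C₁ s, ind (latimage (hfull s z₂ w x.1 x.2) ∩ calTs s = ∅)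

/-- `F_{(α₃,α₄)}(s)`. -/
def Ffull (α₃ α₄ : Zsqrtd 2) (C₁ s : ℝ) : ℝ :=
  (Real.sqrt s)⁻¹ *
    ∫ z₂ in Set.Ioo (-Real.sqrt (s / thetaHat)) (Real.sqrt (s / thetaHat)), ∫ w in Wp,
      ∫ x in Bbox α₃ α₄ C₁ s, ind (latimage (hfull s z₂ w x.1 x.2) ∩ calTs s = ∅)

/-- `v₁ = (α₃, α₄, σ(α₃), σ(α₄))`. -/
def vv1 (α₃ α₄ : Zsqrtd 2) : Fin 4 → ℝ := ![emb α₃, emb α₄, embc α₃, embc α₄]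

/-- `v₂ = (√2α₃, √2α₄, −√2σ(α₃), −√2σ(α₄))`. -/
def vv2 (α₃ α₄ : Zsqrtd 2) : Fin 4 → ℝ :=
  ![Real.sqrt 2 * emb α₃, Real.sqrt 2 * emb α₄,
    -(Real.sqrt 2 * embc α₃), -(Real.sqrt 2 * embc α₄)]

/-- `b₁ = (α₃, α₄, 0, 0)`. -/
def bb1 (α₃ α₄ : Zsqrtd 2) : Fin 4 → ℝ := ![emb α₃, emb α₄, 0, 0]

/-- `b₂ = (0, 0, σ(α₃), σ(α₄))`. -/
def bb2 (α₃ α₄ : Zsqrtd 2) : Fin 4 → ℝ := ![0, 0, embc α₃, embc α₄]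

/-- The subgrid `𝓛_v = v + ℤv₁ + ℤv₂`. -/
def Lv (α₃ α₄ : Zsqrtd 2) (v : Fin 4 → ℝ) : Set (Fin 4 → ℝ) :=
  {u | ∃ m n : ℤ, u = v + (m:ℝ) • vv1 α₃ α₄ + (n:ℝ) • vv2 α₃ α₄}

/-- The filled plane `Π_v = v + ℝb₁ + ℝb₂`. -/
def Piv (α₃ α₄ : Zsqrtd 2) (v : Fin 4 → ℝ) : Set (Fin 4 → ℝ) :=
  {u | ∃ c₁ c₂ : ℝ, u = v + c₁ • bb1 α₃ α₄ + c₂ • bb2 α₃ α₄}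

/-- `d(s) = θ̂^{−1/2}λ^{−2r}s^{1/2}`. -/
def ds (s : ℝ) : ℝ := lam ^ (-(2 * rr s)) * Real.sqrt (s / thetaHat)

/-- The explicit integral representation `Φ(s)` of the limiting gap distribution `F(s)`. -/
def Phi (s : ℝ) : ℝ :=
  (1 / ((2:ℝ) ^ ((11:ℝ)/2) * Real.sqrt thetaHat * zetaK2 * Real.sqrt s)) *
    ∫ z₂ in Set.Ioo (-Real.sqrt (s / thetaHat)) (Real.sqrt (s / thetaHat)), ∫ w in Wp,
      ∫ x in Fdom, ind (latimage (hfull s z₂ w x.1 x.2) ∩ calTs s = ∅)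


lemma one_lt_sqrt_two : (1.4 : ℝ) < √2 := Real.lt_sqrt_of_sq_lt (by norm_num)

lemma sqrt_two_lt : √2 < (1.5 : ℝ) := (Real.sqrt_lt' (by norm_num)).2 (by norm_num)

lemma sqrt_two_mul_self : √2 * √2 = (2 : ℝ) := Real.mul_self_sqrt (by norm_num)

@[simp] lemma emb_zero : emb 0 = 0 := by simp [emb]

@[simp] lemma embc_zero : embc 0 = 0 := by simp [embc]

@[simp] lemma emb_one : emb 1 = 1 := by simp [emb]

@[simp] lemma embc_one : embc 1 = 1 := by simp [embc]

@[simp] lemma emb_add (α β : Zsqrtd 2) : emb (α + β) = emb α + emb β := by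
  simp [emb]; ring

@[simp] lemma embc_add (α β : Zsqrtd 2) : embc (α + β) = embc α + embc β := by
  simp [embc]; ring

@[simp] lemma emb_neg (α : Zsqrtd 2) : emb (-α) = -emb α := by
  simp [emb]; ring

@[simp] lemma embc_neg (α : Zsqrtd 2) : embc (-α) = -embc α := by
  simp [embc]; ring

@[simp] lemma emb_sub (α β : Zsqrtd 2) : emb (α - β) = emb α - emb β := by
  rw [sub_eq_add_neg, emb_add, emb_neg, sub_eq_add_neg]

@[simp] lemma embc_sub (α β : Zsqrtd 2) : embc (α - β) = embc α - embc β := by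
  rw [sub_eq_add_neg, embc_add, embc_neg, sub_eq_add_neg]

@[simp] lemma emb_mul (α β : Zsqrtd 2) : emb (α * β) = emb α * emb β := by
  simp [emb]; linear_combination (-(α.im * β.im : ℝ)) * sqrt_two_mul_self

@[simp] lemma embc_mul (α β : Zsqrtd 2) : embc (α * β) = embc α * embc β := by
  simp [embc]; linear_combination (-(α.im * β.im : ℝ)) * sqrt_two_mul_self

@[simp] lemma emb_pow (α : Zsqrtd 2) (n : ℕ) : emb (α ^ n) = emb α ^ n := by
  induction n with
  | zero => simp
  | succ n ih => rw [pow_succ, emb_mul, ih, pow_succ]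

@[simp] lemma embc_pow (α : Zsqrtd 2) (n : ℕ) : embc (α ^ n) = embc α ^ n := by
  induction n with
  | zero => simp
  | succ n ih => rw [pow_succ, embc_mul, ih, pow_succ]

@[simp] lemma emb_intCast (m : ℤ) : emb (m : Zsqrtd 2) = m := by simp [emb]

@[simp] lemma embc_intCast (m : ℤ) : embc (m : Zsqrtd 2) = m := by simp [embc]

lemma emb_mul_embc (α : Zsqrtd 2) : emb α * embc α = ((α.norm : ℤ) : ℝ) := by
  simp [emb, embc, Zsqrtd.norm]
  linear_combination (-(α.im * α.im : ℝ)) * sqrt_two_mul_self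

lemma norm_ne_zero_of_ne_zero {α : Zsqrtd 2} (h : α ≠ 0) : α.norm ≠ 0 := by
  intro h0
  refine h ((Zsqrtd.norm_eq_zero ?_ α).1 h0)
  intro n hn
  have : n ^ 2 = 2 := by nlinarith
  have h1 : n < 2 := by nlinarith
  have h2 : -2 < n := by nlinarith
  interval_cases n <;> omega

lemma one_le_abs_emb_mul_embc {α : Zsqrtd 2} (h : α ≠ 0) : 1 ≤ |emb α| * |embc α| := by
  rw [← abs_mul, emb_mul_embc]
  exact_mod_cast Int.one_le_abs (norm_ne_zero_of_ne_zero h)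

lemma emb_ne_zero {α : Zsqrtd 2} (h : α ≠ 0) : emb α ≠ 0 := by
  intro h0
  have := one_le_abs_emb_mul_embc h
  simp [h0] at this
  linarith

lemma embc_ne_zero {α : Zsqrtd 2} (h : α ≠ 0) : embc α ≠ 0 := by
  intro h0
  have := one_le_abs_emb_mul_embc h
  simp [h0] at this
  linarith

/-- The fundamental unit `1 + √2` as an element of `ℤ[√2]`. -/
def unitL : Zsqrtd 2 := ⟨1, 1⟩

/-- The inverse `√2 - 1` of the fundamental unit. -/
def unitM : Zsqrtd 2 := ⟨-1, 1⟩

@[simp] lemma emb_unitL : emb unitL = 1 + √2 := by simp [emb, unitL]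

@[simp] lemma embc_unitL : embc unitL = 1 - √2 := by simp [embc, unitL]

@[simp] lemma emb_unitM : emb unitM = √2 - 1 := by simp [emb, unitM]; ring

@[simp] lemma embc_unitM : embc unitM = -(1 + √2) := by simp [embc, unitM]; ring

/-- The point `x` is moved into `(0, 1) × (-1, 1)` by an affine map `x ↦ β₁ x + β₂`
with `β₁ > 0`. -/
def Movable (x₁ x₂ : ℝ) : Prop :=
  ∃ β₁ β₂ : Zsqrtd 2, 0 < emb β₁ ∧ 0 < emb β₁ * x₁ + emb β₂ ∧ emb β₁ * x₁ + emb β₂ < 1 ∧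
    |embc β₁ * x₂ + embc β₂| < 1

lemma Movable.of_affine {x₁ x₂ : ℝ} (γ δ : Zsqrtd 2) (hγ : 0 < emb γ)
    (h : Movable (emb γ * x₁ + emb δ) (embc γ * x₂ + embc δ)) : Movable x₁ x₂ := by
  obtain ⟨β₁, β₂, h0, h1, h2, h3⟩ := h
  have e1 : emb (β₁ * γ) * x₁ + emb (β₁ * δ + β₂) =
      emb β₁ * (emb γ * x₁ + emb δ) + emb β₂ := by simp; ring
  have e2 : embc (β₁ * γ) * x₂ + embc (β₁ * δ + β₂) =
      embc β₁ * (embc γ * x₂ + embc δ) + embc β₂ := by simp; ring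
  refine ⟨β₁ * γ, β₁ * δ + β₂, by simp; positivity, ?_, ?_, ?_⟩
  · rwa [e1]
  · rwa [e1]
  · rwa [e2]

lemma movable_of_small {y₁ y₂ : ℝ} (h₁ : y₁ ≠ 0) (h₂ : y₂ ≠ 0) (h1 : |y₁| < 1)
    (h2 : |y₂| < √2 - 1) : Movable y₁ y₂ := by
  have s1 := one_lt_sqrt_two
  have s2 := sqrt_two_lt
  have s3 := sqrt_two_mul_self
  rw [abs_lt] at h1 h2
  rcases h₁.lt_or_gt with h | h
  · rcases h₂.lt_or_gt with h' | h'
    · refine ⟨1, 1, by simp, ?_, ?_, ?_⟩ <;> simp only [emb_one, embc_one]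
      · linarith
      · linarith
      · rw [abs_lt]; constructor <;> linarith
    · refine ⟨unitM, 1, by simp; linarith, ?_, ?_, ?_⟩ <;>
        simp only [emb_unitM, embc_unitM, emb_one, embc_one]
      · nlinarith
      · nlinarith
      · rw [abs_lt]; constructor <;> nlinarith
  · refine ⟨1, 0, by simp, ?_, ?_, ?_⟩ <;> simp only [emb_one, embc_one, emb_zero, embc_zero]
    · linarith
    · linarith
    · rw [abs_lt]; constructor <;> linarith

lemma exists_embc_mem_Ioo {A B : ℝ} (h : A < B) :
    ∃ β : Zsqrtd 2, 0 < emb β ∧ A < embc β ∧ embc β < B := by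
  have s1 := one_lt_sqrt_two
  have s2 := sqrt_two_lt
  have q0 : (0 : ℝ) ≤ (1 - √2) ^ 2 := sq_nonneg _
  have q1 : (1 - √2) ^ 2 < 1 := by nlinarith
  have hd : 0 < (B - A) / 2 := by linarith
  have ev1 : ∀ᶠ n : ℕ in Filter.atTop, ((1 - √2) ^ 2) ^ n < (B - A) / 2 :=
    (tendsto_pow_atTop_nhds_zero_of_lt_one q0 q1).eventually_lt_const hd
  obtain ⟨n, hn⟩ := ev1.exists
  set e := ((1 - √2) ^ 2) ^ n with he
  have epos : 0 < e := by
    have : (1 - √2) ≠ 0 := by linarith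
    positivity
  set m : ℤ := ⌊A / e⌋ + 1 with hm
  have hm1 : A < m * e := by
    rw [← div_lt_iff₀ epos, hm]; push_cast; exact Int.lt_floor_add_one _
  have hm2 : m * e ≤ A + e := by
    have : (m : ℝ) ≤ A / e + 1 := by rw [hm]; push_cast; linarith [Int.floor_le (A / e)]
    calc m * e ≤ (A / e + 1) * e := by gcongr
      _ = A + e := by field_simp
  set β₀ : Zsqrtd 2 := m * unitL ^ (2 * n) with hβ
  have hc : embc β₀ = m * e := by simp [hβ, he, pow_mul]
  have ev2 : ∀ᶠ k : ℕ in Filter.atTop, -emb β₀ < ((1 + √2) ^ 2) ^ k :=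
    (tendsto_pow_atTop_atTop_of_one_lt (by nlinarith)).eventually_gt_atTop _
  obtain ⟨k, hk1, hk2⟩ := (ev1.and ev2).exists
  have kpos : (0 : ℝ) ≤ ((1 - √2) ^ 2) ^ k := by positivity
  refine ⟨β₀ + unitL ^ (2 * k), ?_, ?_, ?_⟩
  · simp [pow_mul]; linarith
  · rw [embc_add, hc]; simp only [embc_pow, embc_unitL, pow_mul]; linarith
  · rw [embc_add, hc]; simp only [embc_pow, embc_unitL, pow_mul]; linarith

lemma exists_emb_mem_Ioo {A B : ℝ} (h : A < B) : ∃ β : Zsqrtd 2, A < emb β ∧ emb β < B := by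
  obtain ⟨β, -, h1, h2⟩ := exists_embc_mem_Ioo h
  have : emb ⟨β.re, -β.im⟩ = embc β := by simp [emb, embc]; ring
  exact ⟨⟨β.re, -β.im⟩, by rwa [this], by rwa [this]⟩

lemma movable_right_zero {t : ℝ} (ht : t ≠ 0) : Movable t 0 := by
  have s1 := one_lt_sqrt_two
  have s2 := sqrt_two_lt
  rcases ht.lt_or_gt with h | h
  · have h' : 0 < -t := by linarith
    obtain ⟨β, h1, h2⟩ := exists_emb_mem_Ioo (A := √2 / (-t)) (B := (1 + √2) / (-t))
      (by gcongr; linarith)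
    have h0 : 0 < emb β := lt_trans (by positivity) h1
    rw [div_lt_iff₀ h'] at h1
    rw [lt_div_iff₀ h'] at h2
    refine ⟨β, unitL, h0, ?_, ?_, ?_⟩ <;> simp only [emb_unitL, embc_unitL]
    · linarith
    · linarith
    · rw [abs_lt]; constructor <;> linarith
  · obtain ⟨β, h1, h2⟩ := exists_emb_mem_Ioo (A := 0) (B := 1 / t) (by positivity)
    rw [lt_div_iff₀ h] at h2
    exact ⟨β, 0, h1, by simp; positivity, by simpa using h2, by simp⟩

lemma movable_left_zero {t : ℝ} (ht : t ≠ 0) : Movable 0 t := by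
  have s1 := one_lt_sqrt_two
  have s2 := sqrt_two_lt
  have : ∃ β : Zsqrtd 2, 0 < emb β ∧ √2 < embc β * t ∧ embc β * t < 2 + √2 := by
    rcases ht.lt_or_gt with h | h
    · obtain ⟨β, h0, h1, h2⟩ := exists_embc_mem_Ioo (A := (2 + √2) / t) (B := √2 / t)
        (div_lt_div_of_neg_of_lt h (by linarith))
      rw [div_lt_iff_of_neg h] at h1
      rw [lt_div_iff_of_neg h] at h2
      exact ⟨β, h0, h2, h1⟩
    · obtain ⟨β, h0, h1, h2⟩ := exists_embc_mem_Ioo (A := √2 / t) (B := (2 + √2) / t)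
        (by gcongr; linarith)
      rw [div_lt_iff₀ h] at h1
      rw [lt_div_iff₀ h] at h2
      exact ⟨β, h0, h1, h2⟩
  obtain ⟨β, h0, h1, h2⟩ := this
  refine ⟨β, unitM, h0, ?_, ?_, ?_⟩ <;> simp only [emb_unitM, embc_unitM]
  · linarith
  · linarith
  · rw [abs_lt]; constructor <;> linarith

lemma abs_sub_lt_of_one_lt_abs_add {A C : ℝ} (hA : |A| ≤ 1 / 2) (hC : |C| ≤ √2 / 2)
    (h : 1 < |A + C|) : |A - C| < √2 - 1 := by
  have s1 := one_lt_sqrt_two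
  rw [abs_le] at hA hC
  rw [abs_lt]
  rcases lt_abs.1 h with h | h <;> constructor <;> linarith

lemma abs_unit_mul_lt_one {v : ℝ} (hv : |v| < √2 - 1) : |(1 + √2) * v| < 1 := by
  have s3 := sqrt_two_mul_self
  have s0 := Real.sqrt_nonneg 2
  rw [abs_mul, abs_of_nonneg (by linarith)]
  calc (1 + √2) * |v| < (1 + √2) * (√2 - 1) := by gcongr
    _ = 1 := by linear_combination s3

lemma abs_unit_inv_mul_lt_one {v : ℝ} (hv : |v| ≤ 1 / 2 + √2 / 2) : |(√2 - 1) * v| < 1 := by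
  have s3 := sqrt_two_mul_self
  have s1 := one_lt_sqrt_two
  rw [abs_mul, abs_of_nonneg (by linarith)]
  calc (√2 - 1) * |v| ≤ (√2 - 1) * (1 / 2 + √2 / 2) := by
        gcongr; linarith
    _ = 1 / 2 := by linear_combination s3 / 2
    _ < 1 := by norm_num

lemma exists_reduced (x₁ x₂ : ℝ)
    (h : ∀ α : Zsqrtd 2, x₁ + emb α ≠ 0 ∧ x₂ + embc α ≠ 0) :
    ∃ γ δ : Zsqrtd 2, 0 < emb γ ∧ emb γ < 3 ∧ emb γ * x₁ + emb δ ≠ 0 ∧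
      |emb γ * x₁ + emb δ| < 1 ∧ |embc γ * x₂ + embc δ| < 1 := by
  have s1 := one_lt_sqrt_two
  have s2 := sqrt_two_lt
  have s3 := sqrt_two_mul_self
  set a := (x₁ + x₂) / 2 with ha
  set b := (x₁ - x₂) / (2 * √2) with hb
  have hx1 : x₁ = a + b * √2 := by rw [ha, hb]; field_simp; ring
  have hx2 : x₂ = a - b * √2 := by rw [ha, hb]; field_simp; ring
  have ha' := abs_le.1 (abs_sub_round a)
  have hb' := abs_le.1 (abs_sub_round b)
  set p : Zsqrtd 2 := ⟨-round a, -round b⟩ with hp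
  set A := a - round a with hA
  set B := b - round b with hB
  have y1 : x₁ + emb p = A + B * √2 := by simp [hx1, emb, hp, hA, hB]; ring
  have y2 : x₂ + embc p = A - B * √2 := by simp [hx2, embc, hp, hA, hB]; ring
  have ne1 : A + B * √2 ≠ 0 := y1 ▸ (h p).1
  have n1 : A + B * √2 ≠ 1 := by
    have := (h (p - 1)).1
    simp only [emb_sub, emb_one] at this
    intro h'; apply this; linarith
  have n2 : A + B * √2 ≠ -1 := by
    have := (h (p + 1)).1
    simp only [emb_add, emb_one] at this
    intro h'; apply this; linarith
  have n3 : A - B * √2 ≠ 1 := by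
    have := (h (p - 1)).2
    simp only [embc_sub, embc_one] at this
    intro h'; apply this; linarith
  have n4 : A - B * √2 ≠ -1 := by
    have := (h (p + 1)).2
    simp only [embc_add, embc_one] at this
    intro h'; apply this; linarith
  have B1 : B * √2 ≤ √2 / 2 := by nlinarith
  have B2 : -(√2 / 2) ≤ B * √2 := by nlinarith
  set C := B * √2 with hC
  have A' := abs_le.2 ha'
  have C' : |C| ≤ √2 / 2 := abs_le.2 ⟨B2, B1⟩
  by_cases hl : |A + C| < 1
  · by_cases hr : |A - C| < 1
    · refine ⟨1, p, by simp, by simp, ?_, ?_, ?_⟩ <;>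
        simp only [emb_one, embc_one, one_mul, y1, y2]
      · exact ne1
      · exact hl
      · exact hr
    · refine ⟨unitL, unitL * p, by simp; linarith, by simp; linarith, ?_, ?_, ?_⟩ <;>
        simp only [emb_mul, embc_mul, ← mul_add, y1, y2, emb_unitL, embc_unitL]
      · exact mul_ne_zero (by linarith) ne1
      · have hr' : 1 < |A + -C| :=
          lt_of_le_of_ne (not_lt.1 hr) (fun h => (eq_or_eq_neg_of_abs_eq h.symm).elim n3 n4)
        have := abs_sub_lt_of_one_lt_abs_add A' (by rwa [abs_neg]) hr'
        rw [sub_neg_eq_add] at this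
        exact abs_unit_mul_lt_one this
      · rw [abs_mul, abs_sub_comm, ← abs_mul]
        exact abs_unit_inv_mul_lt_one ((abs_sub A C).trans (add_le_add A' C'))
  · refine ⟨unitM, unitM * p, by simp; linarith, by simp; linarith, ?_, ?_, ?_⟩ <;>
        simp only [emb_mul, embc_mul, ← mul_add, y1, y2, emb_unitM, embc_unitM]
    · exact mul_ne_zero (by linarith) ne1
    · exact abs_unit_inv_mul_lt_one ((abs_add_le A C).trans (add_le_add A' C'))
    · have hl' : 1 < |A + C| :=
        lt_of_le_of_ne (not_lt.1 hl) (fun h => (eq_or_eq_neg_of_abs_eq h.symm).elim n1 n2)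
      rw [neg_mul, abs_neg]
      exact abs_unit_mul_lt_one (abs_sub_lt_of_one_lt_abs_add A' C' hl')

lemma movable_of_torsion {x₁ x₂ : ℝ} {n : ℕ} (hn : 0 < n) {q : Zsqrtd 2}
    (h1 : n * x₁ = emb q) (h2 : n * x₂ = embc q)
    (hx : ∀ α : Zsqrtd 2, ¬ (x₁ + emb α = 0 ∧ x₂ + embc α = 0)) : Movable x₁ x₂ := by
  have hn' : (1 : ℝ) ≤ n := by exact_mod_cast hn
  have key : ∀ α : Zsqrtd 2, x₁ + emb α ≠ 0 ∧ x₂ + embc α ≠ 0 := by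
    intro α
    have e1 : emb (q + ((n : ℤ) : Zsqrtd 2) * α) = n * (x₁ + emb α) := by
      simp only [emb_add, emb_mul, emb_intCast, ← h1]; push_cast; ring
    have e2 : embc (q + ((n : ℤ) : Zsqrtd 2) * α) = n * (x₂ + embc α) := by
      simp only [embc_add, embc_mul, embc_intCast, ← h2]; push_cast; ring
    have hne : q + ((n : ℤ) : Zsqrtd 2) * α ≠ 0 := by
      intro h0
      rw [h0, emb_zero] at e1
      rw [h0, embc_zero] at e2
      have hn0 : (n : ℝ) ≠ 0 := by linarith
      exact hx α ⟨(mul_eq_zero.1 e1.symm).resolve_left hn0,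
        (mul_eq_zero.1 e2.symm).resolve_left hn0⟩
    constructor
    · intro h0; exact emb_ne_zero hne (by rw [e1, h0, mul_zero])
    · intro h0; exact embc_ne_zero hne (by rw [e2, h0, mul_zero])
  obtain ⟨γ, δ, g0, g3, k0, k1, k2⟩ := exists_reduced x₁ x₂ key
  rcases k0.lt_or_gt with h | h
  · have e1 : emb (((3 * n : ℤ) : Zsqrtd 2) - γ) * x₁ + emb (-δ - ((3 : ℤ) : Zsqrtd 2) * q) =
        -(emb γ * x₁ + emb δ) := by
      simp only [emb_sub, emb_mul, emb_intCast, ← h1, emb_neg]; push_cast; ring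
    have e2 : embc (((3 * n : ℤ) : Zsqrtd 2) - γ) * x₂ + embc (-δ - ((3 : ℤ) : Zsqrtd 2) * q) =
        -(embc γ * x₂ + embc δ) := by
      simp only [embc_sub, embc_mul, embc_intCast, ← h2, embc_neg]; push_cast; ring
    refine ⟨((3 * n : ℤ) : Zsqrtd 2) - γ, -δ - ((3 : ℤ) : Zsqrtd 2) * q, ?_, ?_, ?_, ?_⟩
    · rw [emb_sub, emb_intCast]; push_cast; linarith
    · rw [e1]; linarith
    · rw [e1]; linarith [(abs_lt.1 k1).1]
    · rwa [e2, abs_neg]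
  · exact ⟨γ, δ, g0, h, (abs_lt.1 k1).2, k2⟩

lemma exists_nat_mul_near (x₁ x₂ : ℝ) {η : ℝ} (hη : 0 < η) :
    ∃ (n : ℕ) (q : Zsqrtd 2), 0 < n ∧ |n * x₁ - emb q| < η ∧ |n * x₂ - embc q| < η := by
  have s1 := one_lt_sqrt_two
  have s2 := sqrt_two_lt
  set a := (x₁ + x₂) / 2 with ha
  set b := (x₁ - x₂) / (2 * √2) with hb
  have hx1 : x₁ = a + b * √2 := by rw [ha, hb]; field_simp; ring
  have hx2 : x₂ = a - b * √2 := by rw [ha, hb]; field_simp; ring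
  let f : ℕ → ℝ × ℝ := fun n => (Int.fract (n * a), Int.fract (n * b))
  have hf : ∀ n, f n ∈ Icc (0 : ℝ × ℝ) 1 := fun n =>
    ⟨⟨Int.fract_nonneg _, Int.fract_nonneg _⟩,
      ⟨(Int.fract_lt_one _).le, (Int.fract_lt_one _).le⟩⟩
  obtain ⟨l, -, φ, hφ, hl⟩ := (isCompact_Icc (a := (0 : ℝ × ℝ)) (b := 1)).tendsto_subseq hf
  obtain ⟨N, hN⟩ := Metric.cauchySeq_iff.1 hl.cauchySeq (η / 3) (by linarith)
  have hd := hN (N + 1) (by omega) N le_rfl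
  have hlt : φ N < φ (N + 1) := hφ (Nat.lt_succ_self N)
  rw [Function.comp, Function.comp, Prod.dist_eq, max_lt_iff, Real.dist_eq, Real.dist_eq] at hd
  obtain ⟨d1, d2⟩ := hd
  simp only [f, Int.fract] at d1 d2
  set i := φ N
  set j := φ (N + 1)
  set A := j * a - ⌊j * a⌋ - (i * a - ⌊i * a⌋) with hA
  set B := j * b - ⌊j * b⌋ - (i * b - ⌊i * b⌋) with hB
  have hBs : |B * √2| < 2 / 3 * η := by
    rw [abs_mul, abs_of_nonneg (Real.sqrt_nonneg 2)]
    nlinarith [abs_nonneg B]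
  rw [abs_lt] at d1 hBs
  refine ⟨j - i, ⟨⌊j * a⌋ - ⌊i * a⌋, ⌊j * b⌋ - ⌊i * b⌋⟩, by omega, ?_, ?_⟩
  · have e : ((j - i : ℕ) : ℝ) * x₁ - emb ⟨⌊j * a⌋ - ⌊i * a⌋, ⌊j * b⌋ - ⌊i * b⌋⟩ =
        A + B * √2 := by
      rw [Nat.cast_sub hlt.le, hx1, hA, hB]; simp only [emb]; push_cast; ring
    rw [e, abs_lt]
    constructor <;> linarith
  · have e : ((j - i : ℕ) : ℝ) * x₂ - embc ⟨⌊j * a⌋ - ⌊i * a⌋, ⌊j * b⌋ - ⌊i * b⌋⟩ =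
        A - B * √2 := by
      rw [Nat.cast_sub hlt.le, hx2, hA, hB]; simp only [embc]; push_cast; ring
    rw [e, abs_lt]
    constructor <;> linarith

lemma movable_of_not_lattice {x₁ x₂ : ℝ}
    (hx : ∀ α : Zsqrtd 2, ¬ (x₁ + emb α = 0 ∧ x₂ + embc α = 0)) : Movable x₁ x₂ := by
  have s1 := one_lt_sqrt_two
  have s2 := sqrt_two_lt
  obtain ⟨n, q, hn, h1, h2⟩ := exists_nat_mul_near x₁ x₂ (η := √2 - 1) (by linarith)
  by_cases h : n * x₁ - emb q = 0 ∧ n * x₂ - embc q = 0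
  · exact movable_of_torsion hn (sub_eq_zero.1 h.1) (sub_eq_zero.1 h.2) hx
  · refine Movable.of_affine ((n : ℤ) : Zsqrtd 2) (-q) (by rw [emb_intCast]; exact_mod_cast hn) ?_
    rw [emb_intCast, embc_intCast, emb_neg, embc_neg, Int.cast_natCast, ← sub_eq_add_neg,
      ← sub_eq_add_neg]
    by_cases ha : n * x₁ - emb q = 0
    · rw [ha]; exact movable_left_zero fun hb => h ⟨ha, hb⟩
    · by_cases hb : n * x₂ - embc q = 0
      · rw [hb]; exact movable_right_zero ha
      · exact movable_of_small ha hb (by linarith) h2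

/-- A quantitative form of `Movable`: the multiplier has size at most `S` and the image
keeps a distance `1 / N` from the sides of `(0, 1) × (-1, 1)`. -/
def MovableBy (N S x₁ x₂ : ℝ) : Prop :=
  ∃ β₁ β₂ : Zsqrtd 2, 0 < emb β₁ ∧ emb β₁ ≤ S ∧ |embc β₁| ≤ S ∧
    1 / N < emb β₁ * x₁ + emb β₂ ∧ emb β₁ * x₁ + emb β₂ < 1 - 1 / N ∧
    |embc β₁ * x₂ + embc β₂| < 1 - 1 / N

lemma MovableBy.of_affine {N S S' x₁ x₂ : ℝ} (γ δ : Zsqrtd 2) (hγ : 0 < emb γ)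
    (hN : 0 ≤ S) (h1 : emb γ ≤ S') (h2 : |embc γ| ≤ S')
    (h : MovableBy N S (emb γ * x₁ + emb δ) (embc γ * x₂ + embc δ)) :
    MovableBy N (S * S') x₁ x₂ := by
  obtain ⟨β₁, β₂, k0, k1, k2, k3, k4, k5⟩ := h
  have e1 : emb (β₁ * γ) * x₁ + emb (β₁ * δ + β₂) =
      emb β₁ * (emb γ * x₁ + emb δ) + emb β₂ := by simp; ring
  have e2 : embc (β₁ * γ) * x₂ + embc (β₁ * δ + β₂) =
      embc β₁ * (embc γ * x₂ + embc δ) + embc β₂ := by simp; ring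
  refine ⟨β₁ * γ, β₁ * δ + β₂, by simp; positivity, ?_, ?_, ?_, ?_, ?_⟩
  · rw [emb_mul]; gcongr
  · rw [embc_mul, abs_mul]; gcongr
  · rwa [e1]
  · rwa [e1]
  · rwa [e2]

/-- Points of norm at most `4` at distance at least `1 / 4` from the lattice. -/
def farSet : Set (ℝ × ℝ) :=
  {x | |x.1| ≤ 4 ∧ |x.2| ≤ 4 ∧ ∀ α : Zsqrtd 2, 1 / 4 ≤ max |x.1 + emb α| |x.2 + embc α|}

lemma isCompact_farSet : IsCompact farSet := by
  have hb : farSet ⊆ Icc (-4) 4 ×ˢ Icc (-4) 4 := fun x hx => ⟨abs_le.1 hx.1, abs_le.1 hx.2.1⟩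
  refine (isCompact_Icc.prod isCompact_Icc).of_isClosed_subset ?_ hb
  have : farSet = {x | |x.1| ≤ 4} ∩ ({x | |x.2| ≤ 4} ∩
      ⋂ α : Zsqrtd 2, {x : ℝ × ℝ | 1 / 4 ≤ max |x.1 + emb α| |x.2 + embc α|}) := by
    ext x; simp [farSet]
  rw [this]
  refine (isClosed_le (by fun_prop) (by fun_prop)).inter
    ((isClosed_le (by fun_prop) (by fun_prop)).inter (isClosed_iInter fun α => ?_))
  exact isClosed_le (by fun_prop) (by fun_prop)

lemma exists_movableBy_farSet : ∃ N : ℝ, 1 ≤ N ∧ ∀ x ∈ farSet, MovableBy N N x.1 x.2 := by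
  let U : ℕ → Set (ℝ × ℝ) := fun n => {x | MovableBy (n + 1) (n + 1) x.1 x.2}
  have hU : ∀ n, IsOpen (U n) := by
    intro n
    have : U n = ⋃ β₁ : Zsqrtd 2, ⋃ β₂ : Zsqrtd 2,
        ⋃ _ : 0 < emb β₁ ∧ emb β₁ ≤ n + 1 ∧ |embc β₁| ≤ n + 1,
        ({x : ℝ × ℝ | 1 / ((n : ℝ) + 1) < emb β₁ * x.1 + emb β₂} ∩
        ({x : ℝ × ℝ | emb β₁ * x.1 + emb β₂ < 1 - 1 / ((n : ℝ) + 1)} ∩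
        {x : ℝ × ℝ | |embc β₁ * x.2 + embc β₂| < 1 - 1 / ((n : ℝ) + 1)})) := by
      ext x
      simp only [U, MovableBy, mem_ofPred_eq, mem_iUnion, mem_inter_iff,
        exists_prop, and_assoc]
    rw [this]
    refine isOpen_iUnion fun β₁ => isOpen_iUnion fun β₂ => isOpen_iUnion fun _ => ?_
    exact (isOpen_lt (by fun_prop) (by fun_prop)).inter
      ((isOpen_lt (by fun_prop) (by fun_prop)).inter (isOpen_lt (by fun_prop) (by fun_prop)))
  have hmono : Monotone U := by
    rintro m n hmn x ⟨β₁, β₂, k0, k1, k2, k3, k4, k5⟩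
    have hmn' : (m : ℝ) + 1 ≤ n + 1 := by exact_mod_cast Nat.succ_le_succ hmn
    have hinv : 1 / ((n : ℝ) + 1) ≤ 1 / (m + 1) := by gcongr
    exact ⟨β₁, β₂, k0, by linarith, by linarith, by linarith, by linarith, by linarith⟩
  have hcov : farSet ⊆ ⋃ n, U n := by
    intro x hx
    have hx' : ∀ α : Zsqrtd 2, ¬ (x.1 + emb α = 0 ∧ x.2 + embc α = 0) := by
      rintro α ⟨h1, h2⟩
      have := hx.2.2 α
      rw [h1, h2, abs_zero, max_self] at this
      norm_num at this
    obtain ⟨β₁, β₂, k0, k1, k2, k3⟩ := movable_of_not_lattice hx'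
    have hlim : Filter.Tendsto (fun n : ℕ => 1 / ((n : ℝ) + 1)) Filter.atTop (nhds 0) :=
      tendsto_one_div_add_atTop_nhds_zero_nat
    have hlim' : Filter.Tendsto (fun n : ℕ => (n : ℝ) + 1) Filter.atTop Filter.atTop :=
      Filter.tendsto_atTop_add_const_right _ _ tendsto_natCast_atTop_atTop
    obtain ⟨n, h1, h2, h3, h4, h5⟩ :=
      ((hlim.eventually_lt_const k1).and
        ((hlim.eventually_lt_const (sub_pos.2 k2)).and
        ((hlim.eventually_lt_const (sub_pos.2 k3)).and
        ((hlim'.eventually_ge_atTop (emb β₁)).and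
        (hlim'.eventually_ge_atTop |embc β₁|))))).exists
    exact mem_iUnion.2 ⟨n, β₁, β₂, k0, h4, h5, h1, by linarith, by linarith⟩
  obtain ⟨n, hn⟩ := isCompact_farSet.elim_directed_cover U hU hcov hmono.directed_le
  exact ⟨n + 1, by linarith [n.cast_nonneg (α := ℝ)], fun x hx => hn hx⟩

lemma mem_farSet_of_annulus {y : ℝ × ℝ} (h1 : 1 / 4 ≤ max |y.1| |y.2|) (h2 : |y.1| ≤ 3 / 4)
    (h3 : |y.2| ≤ 3 / 4) : y ∈ farSet := by
  refine ⟨by linarith, by linarith, fun α => ?_⟩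
  by_cases hα : α = 0
  · simpa [hα] using h1
  · have hn := one_le_abs_emb_mul_embc hα
    have t1 : |emb α| ≤ |y.1 + emb α| + |y.1| := by
      simpa using abs_sub (y.1 + emb α) y.1
    have t2 : |embc α| ≤ |y.2 + embc α| + |y.2| := by
      simpa using abs_sub (y.2 + embc α) y.2
    by_contra! hc
    have hc' := max_lt_iff.1 hc
    have u1 : |emb α| < 1 := by linarith
    have u2 : |embc α| < 1 := by linarith
    have := mul_lt_one_of_nonneg_of_lt_one_left (abs_nonneg (emb α)) u1 u2.le
    linarith

lemma exists_unit_pow_mem {m : ℝ} (h0 : 0 < m) (h1 : m < 1 / 4) :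
    ∃ k : ℕ, 1 / 4 ≤ (1 + √2) ^ k * m ∧ (1 + √2) ^ k * m ≤ 3 / 4 := by
  have s1 := one_lt_sqrt_two
  have s2 := sqrt_two_lt
  obtain ⟨n, hn1, hn2⟩ := exists_nat_pow_near (x := 1 / (4 * m)) (y := 1 + √2)
    ((one_le_div (by positivity)).2 (by linarith)) (by linarith)
  rw [le_div_iff₀ (by positivity)] at hn1
  rw [div_lt_iff₀ (by positivity)] at hn2
  refine ⟨n + 1, by linarith, ?_⟩
  have : (1 + √2) ^ (n + 1) * m = (1 + √2) * ((1 + √2) ^ n * (4 * m)) / 4 := by ring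
  nlinarith

lemma exists_movableBy_near {T : ℝ} {y₁ y₂ : ℝ} (hT : 1 / T < max |y₁| |y₂|) (hT0 : 1 ≤ T)
    (hy : max |y₁| |y₂| < 1 / 4) :
    ∃ γ : Zsqrtd 2, 0 < emb γ ∧ emb γ ≤ T ∧ |embc γ| ≤ T ∧
      (emb γ * y₁, embc γ * y₂) ∈ farSet := by
  have s1 := one_lt_sqrt_two
  have s2 := sqrt_two_lt
  have s3 := sqrt_two_mul_self
  have hTp : 0 < T := by linarith
  have hm0 : 0 < max |y₁| |y₂| := lt_trans (by positivity) hT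
  obtain ⟨k, hk1, hk2⟩ := exists_unit_pow_mem hm0 hy
  have hkT : (1 + √2) ^ k ≤ T := by
    have : (1 + √2) ^ k * (1 / T) ≤ 1 :=
      (mul_le_mul_of_nonneg_left hT.le (by positivity)).trans (by linarith)
    rw [mul_one_div, div_le_one hTp] at this
    exact this
  have hs : (√2 - 1) ^ k ≤ 1 := pow_le_one₀ (by linarith) (by linarith)
  have hs0 : 0 < (√2 - 1) ^ k := pow_pos (by linarith) k
  have habs : |1 - √2| = √2 - 1 := by rw [abs_of_neg (by linarith)]; ring
  have habs' : |-(1 + √2)| = 1 + √2 := by rw [abs_neg, abs_of_pos (by linarith)]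
  have hp : 0 < (1 + √2) ^ k := by positivity
  rcases le_total |y₂| |y₁| with h | h
  · rw [max_eq_left h] at hk1 hk2 hy
    refine ⟨unitL ^ k, by simp; positivity, by simpa using hkT, ?_, ?_⟩
    · simp only [embc_pow, embc_unitL, abs_pow, habs]; linarith
    · have e1 : |(1 + √2) ^ k * y₁| = (1 + √2) ^ k * |y₁| := by rw [abs_mul, abs_of_pos hp]
      apply mem_farSet_of_annulus <;> simp only [emb_pow, embc_pow, emb_unitL, embc_unitL]
      · rw [e1]; exact hk1.trans (le_max_left _ _)
      · rwa [e1]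
      · rw [abs_mul, abs_pow, habs]
        nlinarith [abs_nonneg y₂]
  · rw [max_eq_right h] at hk1 hk2 hy
    refine ⟨unitM ^ k, by simpa using hs0, by simp; linarith, ?_, ?_⟩
    · simpa only [embc_pow, embc_unitM, abs_pow, habs'] using hkT
    · have e1 : |(-(1 + √2)) ^ k * y₂| = (1 + √2) ^ k * |y₂| := by
        rw [abs_mul, abs_pow, habs']
      apply mem_farSet_of_annulus <;> simp only [emb_pow, embc_pow, emb_unitM, embc_unitM]
      · rw [e1]; exact hk1.trans (le_max_right _ _)
      · rw [abs_mul, abs_of_pos hs0]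
        nlinarith [abs_nonneg y₁]
      · rwa [e1]

lemma exists_movableBy : ∃ N : ℝ, 1 ≤ N ∧ ∀ T : ℝ, 1 ≤ T → ∀ x : ℝ × ℝ, |x.1| ≤ 4 → |x.2| ≤ 4 →
    (∃ α : Zsqrtd 2, |x.1 + emb α| ≤ 1 / T ∧ |x.2 + embc α| ≤ 1 / T) ∨
      MovableBy N (N * T) x.1 x.2 := by
  obtain ⟨N, hN, H⟩ := exists_movableBy_farSet
  refine ⟨N, hN, fun T hT x h1 h2 => ?_⟩
  by_cases hf : x ∈ farSet
  · right
    refine MovableBy.of_affine 1 0 (by simp) (by linarith) (by simpa) (by simpa) ?_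
    simpa using H x hf
  · have : ∃ α : Zsqrtd 2, max |x.1 + emb α| |x.2 + embc α| < 1 / 4 := by
      by_contra! hc
      exact hf ⟨h1, h2, hc⟩
    obtain ⟨α, hα⟩ := this
    rcases le_or_gt (max |x.1 + emb α| |x.2 + embc α|) (1 / T) with h | h
    · exact Or.inl ⟨α, (le_max_left _ _).trans h, (le_max_right _ _).trans h⟩
    · right
      obtain ⟨γ, g0, g1, g2, g3⟩ := exists_movableBy_near h hT hα
      refine MovableBy.of_affine γ (γ * α) g0 (by linarith) g1 g2 ?_
      simpa only [emb_mul, embc_mul, ← mul_add] using H _ g3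

lemma thetaHat_pos : 0 < thetaHat := by
  unfold thetaHat
  positivity

lemma lam_pos : 0 < lam := by
  unfold lam
  positivity

lemma one_lt_lam : 1 < lam := by
  have := one_lt_sqrt_two
  unfold lam
  linarith

lemma lam_zpow_sq_le {s : ℝ} (hs : 0 < s) : (lam ^ (2 * rr s)) ^ 2 ≤ √s := by
  have hl : 1 < lam ^ 2 := one_lt_pow₀ one_lt_lam two_ne_zero
  have h1 := Int.floor_le (Real.logb (lam ^ 2) (s ^ ((1 : ℝ) / 4)))
  rw [Real.le_logb_iff_rpow_le hl (by positivity), Real.rpow_intCast] at h1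
  calc (lam ^ (2 * rr s)) ^ 2 ≤ (s ^ ((1 : ℝ) / 4)) ^ 2 := by
        rw [_root_.zpow_mul]
        have : (0 : ℝ) ≤ (lam ^ (2 : ℤ)) ^ rr s := by have := lam_pos; positivity
        exact pow_le_pow_left₀ this h1 2
    _ = √s := by
        rw [← Real.rpow_natCast, ← Real.rpow_mul hs.le, Real.sqrt_eq_rpow]; norm_num

lemma sqrt_le_lam_zpow_sq {s : ℝ} (hs : 0 < s) : √s ≤ lam ^ 4 * (lam ^ (2 * rr s)) ^ 2 := by
  have hlp := lam_pos
  have hl : 1 < lam ^ 2 := one_lt_pow₀ one_lt_lam two_ne_zero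
  have h1 := (Int.lt_floor_add_one (Real.logb (lam ^ 2) (s ^ ((1 : ℝ) / 4)))).le
  rw [Real.logb_le_iff_le_rpow hl (by positivity)] at h1
  have h2 : s ^ ((1 : ℝ) / 4) ≤ lam ^ 2 * lam ^ (2 * rr s) := by
    refine h1.trans_eq ?_
    rw [Real.rpow_add (by positivity), Real.rpow_intCast, Real.rpow_one, _root_.zpow_mul, mul_comm]
    rfl
  calc √s = (s ^ ((1 : ℝ) / 4)) ^ 2 := by
        rw [← Real.rpow_natCast, ← Real.rpow_mul hs.le, Real.sqrt_eq_rpow]; norm_num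
    _ ≤ (lam ^ 2 * lam ^ (2 * rr s)) ^ 2 := pow_le_pow_left₀ (by positivity) h2 2
    _ = lam ^ 4 * (lam ^ (2 * rr s)) ^ 2 := by ring

lemma hz_apply {a b : ℝ} (h : 0 < a ^ 2 + b ^ 2) (x : ℝ) :
    hz (a, b) x 0 0 = b / (a ^ 2 + b ^ 2) + x * a ∧
    hz (a, b) x 0 1 = -(a / (a ^ 2 + b ^ 2)) + x * b ∧
    hz (a, b) x 1 0 = a ∧ hz (a, b) x 1 1 = b := by
  have hs : √(a ^ 2 + b ^ 2) ^ 2 = a ^ 2 + b ^ 2 := Real.sq_sqrt h.le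
  have hp : 0 < √(a ^ 2 + b ^ 2) := Real.sqrt_pos.2 h
  simp only [hz, nmat, amat, Matrix.mul_apply, Fin.sum_univ_two, Matrix.of_apply,
    Matrix.cons_val', Matrix.cons_val_zero, Matrix.cons_val_one, Matrix.cons_val_fin_one]
  generalize √(a ^ 2 + b ^ 2) = ρ at hs hp
  rw [← hs]
  refine ⟨?_, ?_, ?_, ?_⟩ <;> field_simp <;> ring

lemma vecMul_bd (β₁ β₂ : Zsqrtd 2) (A B : Matrix (Fin 2) (Fin 2) ℝ) :
    Matrix.vecMul (latvec β₁ β₂) (bd A B) =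
      ![emb β₁ * A 0 0 + emb β₂ * A 1 0, emb β₁ * A 0 1 + emb β₂ * A 1 1,
        embc β₁ * B 0 0 + embc β₂ * B 1 0, embc β₁ * B 0 1 + embc β₂ * B 1 1] := by
  ext i
  fin_cases i <;> simp [Matrix.vecMul, dotProduct, Fin.sum_univ_four, latvec, bd]

lemma latimage_inter_calTs_nonempty {s z₂ : ℝ} {w x : ℝ × ℝ} (hs : 0 < s)
    (hw : 0 < w.1 ^ 2 + w.2 ^ 2) (β₁ β₂ : Zsqrtd 2)
    (hT : ((lam ^ (2 * rr s)) ^ 2 / (√(s / thetaHat) ^ 2 + z₂ ^ 2) * emb β₁ * z₂ +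
          (emb β₁ * x.1 + emb β₂) * √(s / thetaHat),
        -((lam ^ (2 * rr s)) ^ 2 / (√(s / thetaHat) ^ 2 + z₂ ^ 2) * emb β₁ * √(s / thetaHat)) +
          (emb β₁ * x.1 + emb β₂) * z₂) ∈ Tset s)
    (hW : (embc β₁ / (lam ^ (2 * rr s)) ^ 2 * (w.2 / (w.1 ^ 2 + w.2 ^ 2)) +
          (embc β₁ * x.2 + embc β₂) * w.1,
        embc β₁ / (lam ^ (2 * rr s)) ^ 2 * (-(w.1 / (w.1 ^ 2 + w.2 ^ 2))) +
          (embc β₁ * x.2 + embc β₂) * w.2) ∈ Woct) :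
    (latimage (hfull s z₂ w x.1 x.2) ∩ calTs s).Nonempty := by
  have hl : 0 < lam ^ (2 * rr s) := zpow_pos lam_pos _
  have hSp : 0 < √(s / thetaHat) := Real.sqrt_pos.2 (div_pos hs thetaHat_pos)
  refine ⟨_, ⟨_, ⟨β₁, β₂, rfl⟩, rfl⟩, ?_⟩
  simp only [hfull, vecMul_bd, calTs, calT, mem_ofPred_eq, _root_.zpow_neg, Prod.smul_mk, smul_eq_mul]
  set l := lam ^ (2 * rr s)
  set S := √(s / thetaHat)
  have p1 : 0 < (l⁻¹ * S) ^ 2 + (l⁻¹ * z₂) ^ 2 := by positivity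
  have p2 : 0 < (l * w.1) ^ 2 + (l * w.2) ^ 2 := by
    have : (l * w.1) ^ 2 + (l * w.2) ^ 2 = l ^ 2 * (w.1 ^ 2 + w.2 ^ 2) := by ring
    rw [this]; positivity
  have p3 : 0 < S ^ 2 + z₂ ^ 2 := by positivity
  have q1 : (l⁻¹ * S) ^ 2 + (l⁻¹ * z₂) ^ 2 = (S ^ 2 + z₂ ^ 2) / l ^ 2 := by field_simp
  have q2 : (l * w.1) ^ 2 + (l * w.2) ^ 2 = l ^ 2 * (w.1 ^ 2 + w.2 ^ 2) := by ring
  obtain ⟨a1, a2, a3, a4⟩ := hz_apply p1 x.1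
  obtain ⟨b1, b2, b3, b4⟩ := hz_apply p2 x.2
  have hlw : l • w = (l * w.1, l * w.2) := rfl
  rw [hlw, a1, a2, a3, a4, b1, b2, b3, b4, q1, q2]
  constructor
  · convert hT using 2
    · simp only [Matrix.cons_val_zero]; field_simp; ring
    · simp only [Matrix.cons_val_one, Matrix.cons_val_zero]; field_simp; ring
  · convert hW using 2
    · simp; field_simp; ring
    · simp; field_simp; ring

lemma triangle_of_nonneg {S z e u δ : ℝ} (hz0 : 0 ≤ z) (hz : z < S) (he0 : 0 < e) (he : e < δ)
    (hu : δ < u) (hu' : u < 1 - δ) :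
    0 < e * z + u * S ∧ e * z + u * S < S ∧ |-(e * S) + u * z| < e * z + u * S := by
  have hS : 0 < S := by linarith
  have h1 : 0 ≤ e * z := by positivity
  have h2 : e * z ≤ e * S := by gcongr
  have h3 : e * S < δ * S := by gcongr
  have h4 : δ * S < u * S := by gcongr
  have h5 : u * S < (1 - δ) * S := by gcongr
  have h6 : 0 ≤ u * z := mul_nonneg (by linarith) hz0
  have h7 : u * z ≤ u * S := by gcongr; linarith
  have h8 : 0 < e * S := by positivity
  refine ⟨by linarith, by linarith, ?_⟩
  rw [abs_lt]; constructor <;> linarith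

lemma triangle_of_nonpos {S z e u δ : ℝ} (hz0 : z ≤ 0) (hz : -z < S) (he0 : e < 0) (he : -e < δ)
    (hu : δ < u) (hu' : u < 1 - δ) :
    0 < e * z + u * S ∧ e * z + u * S < S ∧ |-(e * S) + u * z| < e * z + u * S := by
  have := triangle_of_nonneg (neg_nonneg.2 hz0) hz (neg_pos.2 he0) he hu hu'
  rw [neg_mul_neg] at this
  have e1 : -(-e * S) + u * -z = -(-(e * S) + u * z) := by ring
  rwa [e1, abs_neg] at this

lemma one_le_lam_div : 1 ≤ lam / √2 := by
  rw [one_le_div (by positivity)]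
  unfold lam
  linarith

lemma mem_Woct_of_perturb {w : ℝ × ℝ} (hw : w ∈ Woct) {f₁ f₂ v δ : ℝ} (hδ : 0 < δ)
    (h1 : |f₁| ≤ δ) (h2 : |f₂| ≤ δ) (hv : |v| < 1 - δ) :
    (f₁ + v * w.1, f₂ + v * w.2) ∈ Woct := by
  obtain ⟨w1, w2, w3⟩ := hw
  have hl := one_le_lam_div
  have hl2 : 2 < lam := by have := one_lt_sqrt_two; unfold lam; linarith
  have k1 : |f₁ + v * w.1| ≤ δ + |v| * |w.1| := by
    rw [← abs_mul]; exact (abs_add_le _ _).trans (by linarith)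
  have k2 : |f₂ + v * w.2| ≤ δ + |v| * |w.2| := by
    rw [← abs_mul]; exact (abs_add_le _ _).trans (by linarith)
  have hv0 := abs_nonneg v
  refine ⟨k1.trans_lt ?_, k2.trans_lt ?_, (add_le_add k1 k2).trans_lt ?_⟩
  · have : |v| * |w.1| ≤ |v| * (lam / √2) := by gcongr
    nlinarith
  · have : |v| * |w.2| ≤ |v| * (lam / √2) := by gcongr
    nlinarith
  · have : |v| * (|w.1| + |w.2|) ≤ |v| * lam := by gcongr
    nlinarith

lemma le_normSq_of_mem_Wp {w : ℝ × ℝ} (hw : w ∈ Wp) : 1 / 16 ≤ w.1 ^ 2 + w.2 ^ 2 := by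
  have s1 := one_lt_sqrt_two
  have s2 := sqrt_two_lt
  have s3 := sqrt_two_mul_self
  by_contra! hc
  have h1 : |w.1| < 1 / 4 := abs_lt_of_sq_lt_sq (by nlinarith [sq_nonneg w.2]) (by norm_num)
  have h2 : |w.2| < 1 / 4 := abs_lt_of_sq_lt_sq (by nlinarith [sq_nonneg w.1]) (by norm_num)
  have hl := one_le_lam_div
  have hl2 : 2 < lam := by unfold lam; linarith
  have e : ∀ t : ℝ, |(√2 + 1) * t| = (√2 + 1) * |t| := fun t => by
    rw [abs_mul, abs_of_pos (by positivity)]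
  refine hw.2 ⟨((√2 + 1) * w.1, (√2 + 1) * w.2), ⟨?_, ?_, ?_⟩, ?_⟩
  · rw [e]; nlinarith
  · rw [e]; nlinarith
  · rw [e, e]; nlinarith
  · ext
    · simp; linear_combination w.1 * s3
    · simp; linear_combination w.2 * s3

lemma abs_div_normSq_le {a b : ℝ} (h : 1 / 16 ≤ a ^ 2 + b ^ 2) :
    |a / (a ^ 2 + b ^ 2)| ≤ 4 ∧ |b / (a ^ 2 + b ^ 2)| ≤ 4 := by
  have hp : 0 < a ^ 2 + b ^ 2 := by linarith
  rw [abs_div, abs_div, abs_of_pos hp, div_le_iff₀ hp, div_le_iff₀ hp]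
  constructor
  · nlinarith [sq_abs a, sq_nonneg b, sq_nonneg (4 * |a| - 1)]
  · nlinarith [sq_abs b, sq_nonneg a, sq_nonneg (4 * |b| - 1)]

lemma disjoint_boxes {C s : ℝ} (h : C / √s ≤ 1 / 4) {α β : Zsqrtd 2} (hne : α ≠ β) :
    Bbox 1 α C s ∩ Bbox 1 β C s = ∅ := by
  refine Set.eq_empty_of_forall_notMem fun x hx => ?_
  obtain ⟨⟨h1, h2⟩, h3, h4⟩ := hx
  simp only [emb_one, embc_one, div_one] at h1 h2 h3 h4
  have hn := one_le_abs_emb_mul_embc (sub_ne_zero.2 hne)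
  have k1 : |emb (α - β)| ≤ 1 / 2 := by
    have := abs_sub (x.1 + emb α) (x.1 + emb β)
    rw [add_sub_add_left_eq_sub, ← emb_sub] at this
    linarith
  have k2 : |embc (α - β)| ≤ 1 / 2 := by
    have := abs_sub (x.2 + embc α) (x.2 + embc β)
    rw [add_sub_add_left_eq_sub, ← embc_sub] at this
    linarith
  have := mul_le_mul k1 k2 (abs_nonneg _) (by norm_num)
  linarith

lemma abs_le_four_of_mem_Fdom {x : ℝ × ℝ} (hx : x ∈ Fdom) : |x.1| ≤ 4 ∧ |x.2| ≤ 4 := by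
  obtain ⟨a, ⟨a0, a1⟩, b, ⟨b0, b1⟩, rfl⟩ := hx
  have s1 := one_lt_sqrt_two
  have s2 := sqrt_two_lt
  have h1 : 0 ≤ b * √2 := by positivity
  have h2 : b * √2 ≤ 1 * √2 := by gcongr
  constructor <;> · rw [abs_le]; constructor <;> dsimp only <;> linarith

lemma re_im_mem_Icc {α : Zsqrtd 2} (h1 : |emb α| ≤ 5) (h2 : |embc α| ≤ 5) :
    α.re ∈ Finset.Icc (-5 : ℤ) 5 ∧ α.im ∈ Finset.Icc (-5 : ℤ) 5 := by
  have s1 := one_lt_sqrt_two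
  unfold emb at h1
  unfold embc at h2
  rw [abs_le] at h1 h2
  rw [Finset.mem_Icc, Finset.mem_Icc]
  refine ⟨⟨?_, ?_⟩, ?_, ?_⟩
  · have : (-5 : ℝ) ≤ α.re := by linarith
    exact_mod_cast this
  · have : (α.re : ℝ) ≤ 5 := by linarith
    exact_mod_cast this
  · have : (-5 : ℝ) ≤ α.im := by
      by_contra! hc
      nlinarith
    exact_mod_cast this
  · have : (α.im : ℝ) ≤ 5 := by
      by_contra! hc
      nlinarith
    exact_mod_cast this

/-- Outside the box of radius `C / √s` around the lattice, both signs of `z₂` are handled by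
`MovableBy` applied to `x` or to `-x`. -/
lemma nonempty_of_movableBy {N C s z₂ : ℝ} {w x : ℝ × ℝ} (hN : 1 ≤ N) (hs : 0 < s)
    (hC : C = N ^ 2 * (thetaHat + 4 * lam ^ 4)) (hz₂ : |z₂| < √(s / thetaHat)) (hw : w ∈ Wp)
    (h : MovableBy N (N * (√s / C)) x.1 x.2)
    (h' : MovableBy N (N * (√s / C)) (-x.1) (-x.2)) :
    (latimage (hfull s z₂ w x.1 x.2) ∩ calTs s).Nonempty := by
  have hθ := thetaHat_pos
  have hlam := lam_pos
  have hNp : 0 < N := by linarith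
  have hCp : 0 < C := by rw [hC]; positivity
  have hl : 0 < lam ^ (2 * rr s) := zpow_pos hlam _
  have hl1 := lam_zpow_sq_le hs
  have hl2 := sqrt_le_lam_zpow_sq hs
  have hn := le_normSq_of_mem_Wp hw
  obtain ⟨n1, n2⟩ := abs_div_normSq_le hn
  have hSp : 0 < √(s / thetaHat) := Real.sqrt_pos.2 (div_pos hs hθ)
  have hS2 : √(s / thetaHat) ^ 2 = s / thetaHat := Real.sq_sqrt (by positivity)
  have hsq : 0 < √s := Real.sqrt_pos.2 hs
  have hss : √s * √s = s := Real.mul_self_sqrt hs.le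
  have hδ : 0 < 1 / N := by positivity
  set κ := (lam ^ (2 * rr s)) ^ 2 / (√(s / thetaHat) ^ 2 + z₂ ^ 2) with hκ
  have hκp : 0 < κ := by positivity
  have hκ1 : κ * (N * (√s / C)) < 1 / N := by
    have k1 : κ ≤ √s / (s / thetaHat) := by
      rw [hκ, hS2]
      gcongr
      linarith [sq_nonneg z₂]
    calc κ * (N * (√s / C)) ≤ √s / (s / thetaHat) * (N * (√s / C)) := by gcongr
      _ = N * thetaHat / C := by field_simp; linear_combination hss
      _ < 1 / N := by
        rw [div_lt_div_iff₀ hCp hNp, hC]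
        have : 0 < N ^ 2 * (4 * lam ^ 4) := by positivity
        linarith
  have hf : ∀ β : Zsqrtd 2, |embc β| ≤ N * (√s / C) → ∀ t : ℝ, |t| ≤ 4 →
      |embc β / (lam ^ (2 * rr s)) ^ 2 * t| ≤ 1 / N := by
    intro β hβ t ht
    rw [abs_mul, abs_div, abs_of_pos (pow_pos hl 2)]
    calc |embc β| / (lam ^ (2 * rr s)) ^ 2 * |t|
        ≤ N * (√s / C) / (lam ^ (2 * rr s)) ^ 2 * 4 := by gcongr
      _ ≤ N * (lam ^ 4 * (lam ^ (2 * rr s)) ^ 2 / C) / (lam ^ (2 * rr s)) ^ 2 * 4 := by gcongr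
      _ = 4 * N * lam ^ 4 / C := by field_simp
      _ ≤ 1 / N := by
        rw [div_le_div_iff₀ hCp hNp, hC]
        have : 0 < N ^ 2 * thetaHat := by positivity
        linarith
  rcases le_total 0 z₂ with hz | hz
  · obtain ⟨β₁, β₂, b0, b1, b2, b3, b4, b5⟩ := h
    refine latimage_inter_calTs_nonempty hs (by linarith) β₁ β₂ ?_ ?_
    · rw [abs_of_nonneg hz] at hz₂
      exact triangle_of_nonneg hz hz₂ (by positivity)
        ((mul_le_mul_of_nonneg_left b1 hκp.le).trans_lt hκ1) b3 b4
    · refine mem_Woct_of_perturb hw.1 hδ (hf _ b2 _ n2) (hf _ b2 _ (by rwa [abs_neg])) b5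
  · obtain ⟨β₁, β₂, b0, b1, b2, b3, b4, b5⟩ := h'
    have b6 : κ * emb β₁ < 1 / N := (mul_le_mul_of_nonneg_left b1 hκp.le).trans_lt hκ1
    have b7 : 0 < κ * emb β₁ := by positivity
    rw [mul_neg, ← neg_mul, ← emb_neg] at b3 b4
    rw [mul_neg, ← neg_mul, ← embc_neg] at b5
    rw [← abs_neg, ← embc_neg] at b2
    refine latimage_inter_calTs_nonempty hs (by linarith) (-β₁) β₂ ?_ ?_
    · rw [abs_of_nonpos hz] at hz₂
      exact triangle_of_nonpos hz hz₂ (by rw [emb_neg]; linarith) (by rw [emb_neg]; linarith) b3 b4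
    · refine mem_Woct_of_perturb hw.1 hδ (hf _ b2 _ n2) (hf _ b2 _ (by rwa [abs_neg])) b5

theorem stmt11 : ∃ C₁ > (0:ℝ), ∃ A : Finset (Zsqrtd 2 × Zsqrtd 2), ∃ s₀ > (0:ℝ),
    (∀ p ∈ A, 0 < emb p.1 ∧ IsCoprime p.1 p.2) ∧
    (∀ p ∈ A, ∀ q ∈ A, emb p.2 / emb p.1 = emb q.2 / emb q.1 → p = q) ∧
    ∀ s ≥ s₀,
      (∀ p ∈ A, ∀ q ∈ A, p ≠ q → Bbox p.1 p.2 C₁ s ∩ Bbox q.1 q.2 C₁ s = ∅) ∧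
      (∀ z₂ : ℝ, |z₂| < Real.sqrt (s / thetaHat) → ∀ w ∈ Wp, ∀ x ∈ Fdom,
        latimage (hfull s z₂ w x.1 x.2) ∩ calTs s = ∅ →
        ∃ p ∈ A, x ∈ Bbox p.1 p.2 C₁ s) := by
  obtain ⟨N, hN, H⟩ := exists_movableBy
  have hθ := thetaHat_pos
  have hlam := lam_pos
  obtain ⟨C, hC⟩ : ∃ C, C = N ^ 2 * (thetaHat + 4 * lam ^ 4) := ⟨_, rfl⟩
  have hCp : 0 < C := by rw [hC]; positivity
  let A : Finset (Zsqrtd 2 × Zsqrtd 2) :=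
    (Finset.Icc (-5 : ℤ) 5 ×ˢ Finset.Icc (-5 : ℤ) 5).image fun m => (1, ⟨m.1, m.2⟩)
  have hA : ∀ p ∈ A, p.1 = 1 := by
    intro p hp
    obtain ⟨m, -, rfl⟩ := Finset.mem_image.1 hp
    rfl
  refine ⟨C, hCp, A, (4 * C) ^ 2, by positivity, ?_, ?_, ?_⟩
  · intro p hp
    rw [hA p hp, emb_one]
    exact ⟨one_pos, isCoprime_one_left⟩
  · intro p hp q hq h
    rw [hA p hp, hA q hq, emb_one, div_one, div_one] at h
    refine Prod.ext ((hA p hp).trans (hA q hq).symm) ?_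
    by_contra hne
    exact emb_ne_zero (sub_ne_zero.2 hne) (by rw [emb_sub, h, sub_self])
  · intro s hs
    have hs0 : 0 < s := lt_of_lt_of_le (by positivity) hs
    have hsC : 4 * C ≤ √s := Real.le_sqrt_of_sq_le hs
    have hsp : 0 < √s := by linarith
    have hC4 : C / √s ≤ 1 / 4 := by rw [div_le_div_iff₀ hsp (by norm_num)]; linarith
    constructor
    · intro p hp q hq hne
      rw [hA p hp, hA q hq]
      exact disjoint_boxes hC4 fun h => hne (Prod.ext ((hA p hp).trans (hA q hq).symm) h)
    · intro z₂ hz₂ w hw x hx hempty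
      have hT : 1 ≤ √s / C := by rw [one_le_div hCp]; linarith
      have hinv : 1 / (√s / C) = C / √s := one_div_div _ _
      obtain ⟨x1, x2⟩ := abs_le_four_of_mem_Fdom hx
      have near : ∀ α : Zsqrtd 2, |x.1 + emb α| ≤ 1 / (√s / C) → |x.2 + embc α| ≤ 1 / (√s / C) →
          ∃ p ∈ A, x ∈ Bbox p.1 p.2 C s := by
        intro α h1 h2
        rw [hinv] at h1 h2
        have t1 : |emb α| ≤ |x.1 + emb α| + |x.1| := by
          simpa using abs_sub (x.1 + emb α) x.1
        have t2 : |embc α| ≤ |x.2 + embc α| + |x.2| := by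
          simpa using abs_sub (x.2 + embc α) x.2
        obtain ⟨r, i⟩ := re_im_mem_Icc (α := α) (by linarith) (by linarith)
        refine ⟨(1, α), Finset.mem_image.2 ⟨(α.re, α.im), Finset.mk_mem_product r i, rfl⟩, ?_, ?_⟩
        · simpa using h1
        · simpa using h2
      rcases H _ hT x x1 x2 with ⟨α, h1, h2⟩ | h
      · exact near α h1 h2
      rcases H _ hT (-x) (by simpa using x1) (by simpa using x2) with ⟨α, h1, h2⟩ | h'
      · refine near (-α) ?_ ?_
        · rw [← abs_neg, emb_neg]; convert h1 using 2; simp; ring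
        · rw [← abs_neg, embc_neg]; convert h2 using 2; simp; ring
      · exact absurd hempty
          (nonempty_of_movableBy hN hs0 hC hz₂ hw h h').ne_empty

end
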